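/- Let G ⊆ GL_n(ℝ) be a finite real reflection group and let π_1, …, π_n be a minimal set of algebraically independent homogeneous generators of ℝ[X_1, …, X_n]^G. Then the covariant algebra ℝ[X_1, …, X_n]_G := ℝ[X_1, …, X_n]/(π_1, …, π_n) is isomorphic as a G-module to the regular representation ℝ[G] of G, and ℝ[X_1, …, X_n] ≅ ℝ[X_1, …, X_n]^G ⊗_ℝ ℝ[X_1, …, X_n]_G as graded G-modules. -/

import Mathlib

open MvPolynomial TensorProduct

set_option synthInstance.maxHeartbeats 1000000
set_option maxHeartbeats 1000000

/-- The action of an invertible matrix `M` on polynomials by linear change of variables: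
`X_i ↦ Σ_j M i j • X_j`. -/
noncomputable def polyAct {K : Type*} [CommSemiring K] {n : ℕ}
    (M : Matrix (Fin n) (Fin n) K) :
    MvPolynomial (Fin n) K →ₐ[K] MvPolynomial (Fin n) K :=
  MvPolynomial.aeval (fun i => ∑ j, M i j • MvPolynomial.X j)

/-- A matrix is a reflection if it is not the identity and its fixed-point space
`ker (A - id)` is a hyperplane. -/
def IsReflection {n : ℕ} (A : Matrix (Fin n) (Fin n) ℝ) : Prop :=
  A ≠ 1 ∧ Module.finrank ℝ
    (LinearMap.ker (Matrix.toLin' A - (LinearMap.id : (Fin n → ℝ) →ₗ[ℝ] Fin n → ℝ))) = n - 1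

/-- The action of an element `g` of a subgroup `H ⊆ GLₙ(ℝ)` on polynomials:
`f^g := f ∘ g⁻¹`. -/
noncomputable def subAct {n : ℕ} (H : Subgroup (Matrix (Fin n) (Fin n) ℝ)ˣ) (g : ↥H) :
    MvPolynomial (Fin n) ℝ →ₐ[ℝ] MvPolynomial (Fin n) ℝ :=
  polyAct ((((g⁻¹ : ↥H) : (Matrix (Fin n) (Fin n) ℝ)ˣ) : Matrix (Fin n) (Fin n) ℝ))

/-- The subalgebra of `H`-invariant polynomials. -/
noncomputable def invariantSubalgebra {n : ℕ} (H : Subgroup (Matrix (Fin n) (Fin n) ℝ)ˣ) :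
    Subalgebra ℝ (MvPolynomial (Fin n) ℝ) where
  carrier := {f | ∀ g : ↥H, subAct H g f = f}
  mul_mem' := fun {a b} ha hb g => by rw [map_mul, ha g, hb g]
  one_mem' := fun g => map_one _
  add_mem' := fun {a b} ha hb g => by rw [map_add, ha g, hb g]
  zero_mem' := fun g => map_zero _
  algebraMap_mem' := fun r g => (subAct H g).commutes r

namespace CovAlg

variable {n : ℕ}

lemma polyAct_X (M : Matrix (Fin n) (Fin n) ℝ) (i : Fin n) :
    polyAct M (X i) = ∑ j, M i j • (X j : MvPolynomial (Fin n) ℝ) := by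
  simp [polyAct]

lemma polyAct_polyAct (M N : Matrix (Fin n) (Fin n) ℝ) (f : MvPolynomial (Fin n) ℝ) :
    polyAct M (polyAct N f) = polyAct (N * M) f := by
  have : (polyAct M).comp (polyAct N) = polyAct (N * M) := by
    apply MvPolynomial.algHom_ext
    intro i
    simp only [AlgHom.comp_apply, polyAct_X, map_sum, map_smul, Matrix.mul_apply,
      Finset.smul_sum, Finset.sum_smul, smul_smul]
    rw [Finset.sum_comm]
  exact DFunLike.congr_fun this f

lemma polyAct_one (f : MvPolynomial (Fin n) ℝ) :
    polyAct (1 : Matrix (Fin n) (Fin n) ℝ) f = f := by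
  have : polyAct (1 : Matrix (Fin n) (Fin n) ℝ) = AlgHom.id ℝ _ := by
    apply MvPolynomial.algHom_ext
    intro i
    simp [polyAct_X, Matrix.one_apply]
  rw [this]; rfl

lemma eval_polyAct (M : Matrix (Fin n) (Fin n) ℝ) (f : MvPolynomial (Fin n) ℝ) (x : Fin n → ℝ) :
    eval x (polyAct M f) = eval (M.mulVec x) f := by
  have : (aeval x).comp (polyAct M) = (aeval (M.mulVec x) : MvPolynomial (Fin n) ℝ →ₐ[ℝ] ℝ) := by
    apply MvPolynomial.algHom_ext
    intro i
    simp [polyAct_X, Matrix.mulVec, dotProduct]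
  have := DFunLike.congr_fun this f
  simpa [MvPolynomial.aeval_eq_eval] using this

lemma isHomogeneous_linear (c : Fin n → ℝ) :
    (∑ j, c j • (X j : MvPolynomial (Fin n) ℝ)).IsHomogeneous 1 := by
  apply IsHomogeneous.sum
  intro j _
  rw [MvPolynomial.smul_eq_C_mul]
  exact isHomogeneous_C_mul_X _ _

lemma polyAct_hom (M : Matrix (Fin n) (Fin n) ℝ) {f : MvPolynomial (Fin n) ℝ} {d : ℕ}
    (hf : f.IsHomogeneous d) : (polyAct M f).IsHomogeneous d := by
  have := hf.aeval (fun i => ∑ j, M i j • (X j : MvPolynomial (Fin n) ℝ)) (n := 1)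
    (fun i => isHomogeneous_linear _)
  simpa [polyAct] using this

lemma hc_polyAct (M : Matrix (Fin n) (Fin n) ℝ) (f : MvPolynomial (Fin n) ℝ) (d : ℕ) :
    homogeneousComponent d (polyAct M f) = polyAct M (homogeneousComponent d f) := by
  conv_lhs => rw [← sum_homogeneousComponent f]
  rw [map_sum, map_sum]
  have : ∀ i ∈ Finset.range (f.totalDegree + 1),
      homogeneousComponent d (polyAct M (homogeneousComponent i f)) =
      if d = i then polyAct M (homogeneousComponent d f) else 0 := by
    intro i _
    have h := polyAct_hom M (homogeneousComponent_isHomogeneous i f)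
    rw [homogeneousComponent_of_mem h]
    split_ifs with h1 <;> simp_all
  rw [Finset.sum_congr rfl this, Finset.sum_ite_eq]
  split_ifs with h
  · rfl
  · rw [homogeneousComponent_eq_zero d f (by simpa using h), map_zero]

lemma totalDegree_polyAct_le (M : Matrix (Fin n) (Fin n) ℝ) (f : MvPolynomial (Fin n) ℝ) :
    (polyAct M f).totalDegree ≤ f.totalDegree := by
  conv_lhs => rw [← sum_homogeneousComponent f]
  rw [map_sum]
  apply totalDegree_finsetSum_le
  intro i hi
  exact ((polyAct_hom M (homogeneousComponent_isHomogeneous i f)).totalDegree_le).trans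
    (by simpa [Nat.lt_succ_iff] using hi)

lemma polyAct_sub_dvd (M : Matrix (Fin n) (Fin n) ℝ) (u c : Fin n → ℝ)
    (hM : ∀ i j, M i j = (1 : Matrix (Fin n) (Fin n) ℝ) i j + u i * c j)
    (f : MvPolynomial (Fin n) ℝ) :
    (∑ j, c j • (X j : MvPolynomial (Fin n) ℝ)) ∣ polyAct M f - f := by
  rw [← Ideal.mem_span_singleton, ← Ideal.Quotient.eq]
  set J := Ideal.span {∑ j, c j • (X j : MvPolynomial (Fin n) ℝ)}
  have : (Ideal.Quotient.mkₐ ℝ J).comp (polyAct M) = (Ideal.Quotient.mkₐ ℝ J) := by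
    apply MvPolynomial.algHom_ext
    intro i
    simp only [AlgHom.comp_apply, Ideal.Quotient.mkₐ_eq_mk]
    rw [Ideal.Quotient.eq, Ideal.mem_span_singleton, polyAct_X]
    refine ⟨C (u i), ?_⟩
    simp only [hM, add_smul, Finset.sum_add_distrib, Matrix.one_apply, ite_smul, one_smul, zero_smul,
      Finset.sum_ite_eq, Finset.mem_univ, if_true, add_sub_cancel_left, mul_smul,
      ← Finset.smul_sum]
    rw [MvPolynomial.smul_eq_C_mul, mul_comm]
  exact DFunLike.congr_fun this f

lemma reflection_form (A : Matrix (Fin n) (Fin n) ℝ) (hA : IsReflection A) :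
    ∃ u c : Fin n → ℝ, (∑ j, c j • (X j : MvPolynomial (Fin n) ℝ)) ≠ 0 ∧
      ∀ i j, A i j = (1 : Matrix (Fin n) (Fin n) ℝ) i j + u i * c j := by
  obtain ⟨h1, h2⟩ := hA
  set T := Matrix.toLin' A - (LinearMap.id : (Fin n → ℝ) →ₗ[ℝ] Fin n → ℝ) with hT
  have hrk := LinearMap.finrank_range_add_finrank_ker T
  rw [h2] at hrk
  simp only [Module.finrank_fintype_fun_eq_card, Fintype.card_fin] at hrk
  have hn : 0 < n := by
    rcases Nat.eq_zero_or_pos n with rfl | h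
    · exact absurd (Subsingleton.elim A 1) h1
    · exact h
  have hr : Module.finrank ℝ (LinearMap.range T) = 1 := by omega
  obtain ⟨⟨u, hu⟩, hu0, hspan⟩ := finrank_eq_one_iff'.mp hr
  have hTe : ∀ j, ∃ c : ℝ, T (Pi.single j 1) = c • u := by
    intro j
    obtain ⟨c, hc⟩ := hspan ⟨T (Pi.single j 1), LinearMap.mem_range_self _ _⟩
    exact ⟨c, by simpa using (congrArg Subtype.val hc).symm⟩
  choose c hc using hTe
  have key : ∀ i j, A i j = (1 : Matrix (Fin n) (Fin n) ℝ) i j + u i * c j := by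
    intro i j
    have := congrFun (hc j) i
    simp [hT, Matrix.one_apply, Pi.single_apply] at this ⊢
    linarith
  refine ⟨u, c, ?_, key⟩
  intro h0
  apply h1
  ext i j
  rw [key]
  have : c j = 0 := by
    have := congrArg (coeff (Finsupp.single j 1)) h0
    simpa [coeff_sum, coeff_X, Finsupp.single_left_inj] using this
  simp [this]

lemma subAct_mul (H : Subgroup (Matrix (Fin n) (Fin n) ℝ)ˣ) (g h : H)
    (f : MvPolynomial (Fin n) ℝ) : subAct H (g * h) f = subAct H g (subAct H h f) := by
  simp only [subAct, polyAct_polyAct]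
  congr 2

lemma subAct_one (H : Subgroup (Matrix (Fin n) (Fin n) ℝ)ˣ)
    (f : MvPolynomial (Fin n) ℝ) : subAct H 1 f = f := by
  simp [subAct, polyAct_one]

lemma subAct_inv_cancel (H : Subgroup (Matrix (Fin n) (Fin n) ℝ)ˣ) (g : H)
    (f : MvPolynomial (Fin n) ℝ) : subAct H g⁻¹ (subAct H g f) = f := by
  rw [← subAct_mul, inv_mul_cancel, subAct_one]

/-- averaging operator -/
noncomputable def avg (H : Subgroup (Matrix (Fin n) (Fin n) ℝ)ˣ) [Fintype H] :
    MvPolynomial (Fin n) ℝ →ₗ[ℝ] MvPolynomial (Fin n) ℝ :=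
  (Fintype.card H : ℝ)⁻¹ • ∑ g : H, (subAct H g).toLinearMap

lemma avg_apply (H : Subgroup (Matrix (Fin n) (Fin n) ℝ)ˣ) [Fintype H]
    (f : MvPolynomial (Fin n) ℝ) :
    avg H f = (Fintype.card H : ℝ)⁻¹ • ∑ g : H, subAct H g f := by
  simp [avg]

lemma avg_mem (H : Subgroup (Matrix (Fin n) (Fin n) ℝ)ˣ) [Fintype H]
    (f : MvPolynomial (Fin n) ℝ) : avg H f ∈ invariantSubalgebra H := by
  intro g
  rw [avg_apply, map_smul, map_sum]
  congr 1
  simp only [← subAct_mul]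
  exact Fintype.sum_equiv (Equiv.mulLeft g) _ _ (fun x => rfl)

lemma avg_mul (H : Subgroup (Matrix (Fin n) (Fin n) ℝ)ˣ) [Fintype H]
    {r : MvPolynomial (Fin n) ℝ} (hr : r ∈ invariantSubalgebra H)
    (f : MvPolynomial (Fin n) ℝ) : avg H (r * f) = r * avg H f := by
  have hr' : ∀ g, subAct H g r = r := hr
  simp only [avg_apply, map_mul, hr', ← Finset.mul_sum, mul_smul_comm]

lemma sub_avg_mem (H : Subgroup (Matrix (Fin n) (Fin n) ℝ)ˣ) [Fintype H]
    (I : Ideal (MvPolynomial (Fin n) ℝ)) (f : MvPolynomial (Fin n) ℝ)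
    (h : ∀ g : H, subAct H g f - f ∈ I) : avg H f - f ∈ I := by
  have : avg H f - f = (Fintype.card H : ℝ)⁻¹ • ∑ g : H, (subAct H g f - f) := by
    have h0 : (Fintype.card H : ℝ) ≠ 0 := by simp
    rw [avg_apply, Finset.sum_sub_distrib, smul_sub, Finset.sum_const, Finset.card_univ,
      ← Nat.cast_smul_eq_nsmul ℝ, inv_smul_smul₀ h0]
  rw [this]
  exact Submodule.smul_of_tower_mem I _ (I.sum_mem fun g _ => h g)

lemma subAct_mem (H : Subgroup (Matrix (Fin n) (Fin n) ℝ)ˣ)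
    (π : Fin n → MvPolynomial (Fin n) ℝ) (hinv : ∀ i, π i ∈ invariantSubalgebra H) (g : H)
    {f : MvPolynomial (Fin n) ℝ} (hf : f ∈ Ideal.span (Set.range π)) :
    subAct H g f ∈ Ideal.span (Set.range π) := by
  have : Ideal.span (Set.range π) ≤ (Ideal.span (Set.range π)).comap (subAct H g) := by
    rw [Ideal.span_le]
    rintro _ ⟨i, rfl⟩
    have : subAct H g (π i) = π i := hinv i g
    simp only [Ideal.coe_comap, Set.mem_preimage, SetLike.mem_coe, this]
    exact Ideal.subset_span ⟨i, rfl⟩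
  exact this hf

lemma aeval_mem (π : Fin n → MvPolynomial (Fin n) ℝ) (Q : MvPolynomial (Fin n) ℝ)
    (hQ : coeff 0 Q = 0) : aeval π Q ∈ Ideal.span (Set.range π) := by
  have h1 : Q ∈ Ideal.span (Set.range (X : Fin n → MvPolynomial (Fin n) ℝ)) := by
    rw [← Set.image_univ, MvPolynomial.mem_ideal_span_X_image]
    intro m hm
    by_contra hcon
    push Not at hcon
    have : m = 0 := by ext i; simpa using hcon i
    rw [mem_support_iff, this] at hm
    exact hm hQ
  have := Ideal.mem_map_of_mem (aeval π : _ →ₐ[ℝ] MvPolynomial (Fin n) ℝ) h1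
  rw [Ideal.map_span, ← Set.range_comp] at this
  convert this using 3
  ext i; simp

lemma chevalley (H : Subgroup (Matrix (Fin n) (Fin n) ℝ)ˣ) [Fintype H]
    (hrefl : H = Subgroup.closure {g : (Matrix (Fin n) (Fin n) ℝ)ˣ |
      g ∈ H ∧ IsReflection (↑g : Matrix (Fin n) (Fin n) ℝ)})
    (π : Fin n → MvPolynomial (Fin n) ℝ)
    (hind : AlgebraicIndependent ℝ π)
    (hinv : ∀ i, π i ∈ invariantSubalgebra H)
    (hgen : ∀ f ∈ invariantSubalgebra H, f ∈ Algebra.adjoin ℝ (Set.range π))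
    (s : Finset (Fin n →₀ ℕ)) (a₀ : Fin n →₀ ℕ) (ha₀ : a₀ ∈ s)
    (hmin : ∀ a ∈ s, a ≤ a₀ → a = a₀) (N : ℕ) :
    ∀ P : (Fin n →₀ ℕ) → MvPolynomial (Fin n) ℝ, (P a₀).totalDegree < N →
      ∑ a ∈ s, aeval π (monomial a (1 : ℝ)) * P a = 0 →
      P a₀ ∈ Ideal.span (Set.range π) := by
  have hmon : ∀ Q : MvPolynomial (Fin n) ℝ, aeval π Q ∈ invariantSubalgebra H := by
    intro Q
    have : Algebra.adjoin ℝ (Set.range π) ≤ invariantSubalgebra H :=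
      Algebra.adjoin_le (by rintro _ ⟨i, rfl⟩; exact hinv i)
    apply this
    rw [Algebra.adjoin_range_eq_range_aeval]
    exact ⟨Q, rfl⟩
  induction N with
  | zero => intro P h; omega
  | succ N ih =>
    intro P hdeg hsum
    set I := Ideal.span (Set.range π) with hI
    -- reflections
    have href : ∀ g : H, IsReflection ((g : (Matrix (Fin n) (Fin n) ℝ)ˣ) : Matrix (Fin n) (Fin n) ℝ) →
        subAct H g⁻¹ (P a₀) - P a₀ ∈ I := by
      intro g hg
      obtain ⟨u, c, hc0, hform⟩ := reflection_form _ hg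
      set α := ∑ j, c j • (X j : MvPolynomial (Fin n) ℝ) with hα
      have hdvd : ∀ f, ∃ q, subAct H g⁻¹ f - f = α * q := by
        intro f
        have := polyAct_sub_dvd _ u c hform f
        simpa [subAct, dvd_def] using this
      choose D hD using hdvd
      have hsum' : ∑ a ∈ s, aeval π (monomial a (1 : ℝ)) * D (P a) = 0 := by
        have : α * ∑ a ∈ s, aeval π (monomial a (1 : ℝ)) * D (P a) = 0 := by
          have e1 : α * ∑ a ∈ s, aeval π (monomial a (1 : ℝ)) * D (P a) =
              subAct H g⁻¹ (∑ a ∈ s, aeval π (monomial a (1 : ℝ)) * P a) -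
              ∑ a ∈ s, aeval π (monomial a (1 : ℝ)) * P a := by
            rw [map_sum, ← Finset.sum_sub_distrib, Finset.mul_sum]
            apply Finset.sum_congr rfl
            intro a _
            have h3 : subAct H g⁻¹ (aeval π (monomial a (1 : ℝ))) = aeval π (monomial a (1 : ℝ)) :=
              hmon _ _
            rw [map_mul, h3, ← mul_sub, hD]; ring
          rw [e1, hsum]; simp
        exact (mul_eq_zero.mp this).resolve_left hc0
      rw [hD]
      apply I.mul_mem_left
      by_cases hz : D (P a₀) = 0
      · rw [hz]; exact I.zero_mem
      · apply ih (fun a => D (P a)) _ hsum'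
        have h1 : (α * D (P a₀)).totalDegree = α.totalDegree + (D (P a₀)).totalDegree :=
          totalDegree_mul_of_isDomain hc0 hz
        rw [(isHomogeneous_linear c).totalDegree hc0, ← hD] at h1
        have h2 : (subAct H g⁻¹ (P a₀) - P a₀).totalDegree ≤ (P a₀).totalDegree :=
          (totalDegree_sub _ _).trans (max_le (totalDegree_polyAct_le _ _) le_rfl)
        show (D (P a₀)).totalDegree < N
        omega
    have hstab : ∀ (g : H) {f}, f ∈ I → subAct H g f ∈ I := fun g f hf => subAct_mem H π hinv g hf
    have hinvmem : ∀ g : H, subAct H g⁻¹ (P a₀) - P a₀ ∈ I → subAct H g (P a₀) - P a₀ ∈ I := by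
      intro g hg
      have := I.neg_mem (hstab g hg)
      rwa [map_sub, ← subAct_mul, mul_inv_cancel, subAct_one, neg_sub] at this
    let K : Subgroup H :=
      { carrier := {g | subAct H g (P a₀) - P a₀ ∈ I}
        mul_mem' := by
          intro a b ha hb
          have := I.add_mem (hstab a hb) ha
          simp only [Set.mem_ofPred_eq] at *
          rw [subAct_mul]
          convert this using 1
          rw [map_sub]; ring
        one_mem' := by simp [subAct_one]
        inv_mem' := by
          intro a ha
          apply hinvmem
          rw [inv_inv]; exact ha }
    have hK : H ≤ K.map H.subtype := by
      conv_lhs => rw [hrefl]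
      rw [Subgroup.closure_le]
      rintro g ⟨hgH, hg⟩
      exact ⟨⟨g, hgH⟩, hinvmem _ (href ⟨g, hgH⟩ hg), rfl⟩
    have hall : ∀ g : H, subAct H g (P a₀) - P a₀ ∈ I := by
      intro g
      obtain ⟨k, hk, hkg⟩ := hK g.2
      have : k = g := Subtype.ext hkg
      rw [← this]; exact hk
    have h1 := sub_avg_mem H I _ hall
    -- average the relation
    have h2 : ∀ f, ∃ Q : MvPolynomial (Fin n) ℝ, aeval π Q = avg H f := by
      intro f
      have := hgen _ (avg_mem H f)
      rw [Algebra.adjoin_range_eq_range_aeval] at this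
      exact this
    choose Q hQ using h2
    have h3 : ∑ a ∈ s, monomial a (1 : ℝ) * Q (P a) = 0 := by
      apply hind
      have h4 := congrArg (avg H) hsum
      rw [map_zero, map_sum] at h4
      rw [map_zero, map_sum, ← h4]
      apply Finset.sum_congr rfl
      intro a _
      rw [map_mul, hQ, avg_mul H (hmon _)]
    have h5 : coeff 0 (Q (P a₀)) = 0 := by
      have h6 := congrArg (coeff a₀) h3
      rw [coeff_sum, coeff_zero, Finset.sum_eq_single a₀] at h6
      · simpa [coeff_monomial_mul'] using h6
      · intro a ha hne
        rw [coeff_monomial_mul', if_neg]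
        exact fun hle => hne (hmin a ha hle)
      · intro h; exact absurd ha₀ h
    have h7 := aeval_mem π _ h5
    rw [hQ] at h7
    have := I.sub_mem h7 h1
    simpa using this


lemma hc_mem (π : Fin n → MvPolynomial (Fin n) ℝ)
    (hhom : ∀ i, ∃ d, 0 < d ∧ (π i).IsHomogeneous d) {f : MvPolynomial (Fin n) ℝ}
    (hf : f ∈ Ideal.span (Set.range π)) (d : ℕ) :
    homogeneousComponent d f ∈ Ideal.span (Set.range π) := by
  let _ := MvPolynomial.gradedAlgebra (σ := Fin n) (R := ℝ)
  have : (Ideal.span (Set.range π)).IsHomogeneous (homogeneousSubmodule (Fin n) ℝ) := by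
    apply Ideal.homogeneous_span
    rintro _ ⟨i, rfl⟩
    obtain ⟨e, -, he⟩ := hhom i
    exact ⟨e, he⟩
  exact homogeneousComponent_mem_of_mem this hf d

/-- graded section -/
lemma exists_proj0 (I : Ideal (MvPolynomial (Fin n) ℝ))
    (hI : ∀ f ∈ I, ∀ d, homogeneousComponent d f ∈ I) :
    ∃ p : MvPolynomial (Fin n) ℝ →ₗ[ℝ] MvPolynomial (Fin n) ℝ,
      (∀ f, p f - f ∈ I) ∧ (∀ f ∈ I, p f = 0) ∧
      ∀ f d, homogeneousComponent d (p f) = p (homogeneousComponent d f) := by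
  obtain ⟨κ, a, ha, hspan, hli⟩ := exists_linearIndependent' ℝ
    (fun m : Fin n →₀ ℕ => Ideal.Quotient.mkₐ ℝ I (monomial m 1))
  have htop : ⊤ ≤ Submodule.span ℝ (Set.range
      ((fun m : Fin n →₀ ℕ => Ideal.Quotient.mkₐ ℝ I (monomial m 1)) ∘ a)) := by
    rw [hspan]
    have h1 : Set.range (fun m : Fin n →₀ ℕ => Ideal.Quotient.mkₐ ℝ I (monomial m 1)) =
      (Ideal.Quotient.mkₐ ℝ I).toLinearMap '' Set.range (basisMonomials (Fin n) ℝ) := by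
      rw [← Set.range_comp]; congr 1
    rw [h1, Submodule.span_image, Module.Basis.span_eq, Submodule.map_top,
      LinearMap.range_eq_top.mpr]
    exact Ideal.Quotient.mkₐ_surjective ℝ I
  let b := Module.Basis.mk hli htop
  let σ : (MvPolynomial (Fin n) ℝ ⧸ I) →ₗ[ℝ] MvPolynomial (Fin n) ℝ :=
    b.constr ℝ (fun k => monomial (a k) (1 : ℝ))
  have hσb : ∀ k, σ (Ideal.Quotient.mkₐ ℝ I (monomial (a k) 1)) = monomial (a k) 1 := by
    intro k
    have h1 : Ideal.Quotient.mkₐ ℝ I (monomial (a k) 1) = b k := by simp [b]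
    rw [h1, Module.Basis.constr_basis]
  have hmkσ : ∀ q, Ideal.Quotient.mkₐ ℝ I (σ q) = q := by
    have : (Ideal.Quotient.mkₐ ℝ I).toLinearMap ∘ₗ σ = LinearMap.id := by
      apply b.ext
      intro k
      have h1 : b k = Ideal.Quotient.mkₐ ℝ I (monomial (a k) 1) := by simp [b]
      simp only [LinearMap.comp_apply, LinearMap.id_apply, AlgHom.toLinearMap_apply]
      rw [h1, hσb]
    exact fun q => LinearMap.congr_fun this q
  -- hc commutes on basis
  have hcσ : ∀ d q, σ (Ideal.Quotient.mkₐ ℝ I (homogeneousComponent d (σ q))) =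
      homogeneousComponent d (σ q) := by
    intro d
    have : σ ∘ₗ (Ideal.Quotient.mkₐ ℝ I).toLinearMap ∘ₗ (homogeneousComponent d) ∘ₗ σ =
        (homogeneousComponent d) ∘ₗ σ := by
      apply b.ext
      intro k
      have h1 : b k = Ideal.Quotient.mkₐ ℝ I (monomial (a k) 1) := by simp [b]
      simp only [LinearMap.comp_apply, AlgHom.toLinearMap_apply]
      rw [h1, hσb, homogeneousComponent_of_mem (isHomogeneous_monomial (1 : ℝ) rfl)]
      split_ifs
      · rw [hσb]
      · simp
    exact fun q => LinearMap.congr_fun this q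
  refine ⟨σ ∘ₗ (Ideal.Quotient.mkₐ ℝ I).toLinearMap, ?_, ?_, ?_⟩
  · intro f
    rw [← Ideal.Quotient.eq]
    exact hmkσ _
  · intro f hf
    have : Ideal.Quotient.mkₐ ℝ I f = 0 := Ideal.Quotient.eq_zero_iff_mem.mpr hf
    simp only [LinearMap.comp_apply, AlgHom.toLinearMap_apply]
    rw [this, map_zero]
  · intro f d
    simp only [LinearMap.comp_apply, AlgHom.toLinearMap_apply]
    rw [← hcσ]
    congr 1
    have : σ (Ideal.Quotient.mkₐ ℝ I f) - f ∈ I := by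
      rw [← Ideal.Quotient.eq]
      exact hmkσ _
    have := hI _ this d
    rw [map_sub] at this
    exact Ideal.Quotient.eq.mpr this

lemma exists_proj (H : Subgroup (Matrix (Fin n) (Fin n) ℝ)ˣ) [Fintype H]
    (I : Ideal (MvPolynomial (Fin n) ℝ))
    (hI : ∀ f ∈ I, ∀ d, homogeneousComponent d f ∈ I)
    (hH : ∀ (g : H), ∀ f ∈ I, subAct H g f ∈ I) :
    ∃ p : MvPolynomial (Fin n) ℝ →ₗ[ℝ] MvPolynomial (Fin n) ℝ,
      (∀ f, p f - f ∈ I) ∧ (∀ f ∈ I, p f = 0) ∧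
      (∀ f d, homogeneousComponent d (p f) = p (homogeneousComponent d f)) ∧
      ∀ (g : H) f, p (subAct H g f) = subAct H g (p f) := by
  obtain ⟨p, h1, h2, h3⟩ := exists_proj0 I hI
  have h0 : (Fintype.card H : ℝ) ≠ 0 := by simp
  let P : MvPolynomial (Fin n) ℝ →ₗ[ℝ] MvPolynomial (Fin n) ℝ :=
    (Fintype.card H : ℝ)⁻¹ • ∑ g : H,
      (subAct H g).toLinearMap ∘ₗ p ∘ₗ (subAct H g⁻¹).toLinearMap
  have hP : ∀ f, P f = (Fintype.card H : ℝ)⁻¹ • ∑ g : H, subAct H g (p (subAct H g⁻¹ f)) := by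
    intro f; simp [P]
  refine ⟨P, ?_, ?_, ?_, ?_⟩
  · intro f
    have : P f - f = (Fintype.card H : ℝ)⁻¹ •
        ∑ g : H, subAct H g (p (subAct H g⁻¹ f) - subAct H g⁻¹ f) := by
      simp only [map_sub, ← subAct_mul, mul_inv_cancel, subAct_one]
      rw [hP, Finset.sum_sub_distrib, smul_sub, Finset.sum_const, Finset.card_univ,
        ← Nat.cast_smul_eq_nsmul ℝ, inv_smul_smul₀ h0]
    rw [this]
    exact Submodule.smul_of_tower_mem I _ (I.sum_mem fun g _ => hH _ _ (h1 _))
  · intro f hf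
    rw [hP]
    simp [h2 _ (hH _ _ hf)]
  · intro f d
    simp only [hP, map_smul, map_sum]
    congr 1
    apply Finset.sum_congr rfl
    intro g _
    simp only [subAct, hc_polyAct, h3]
  · intro k f
    rw [hP, hP, map_smul, map_sum]
    congr 1
    symm
    apply Fintype.sum_equiv (Equiv.mulLeft k)
    intro g
    simp only [Equiv.coe_mulLeft, mul_inv_rev, subAct_mul, subAct_inv_cancel]

lemma mem_of_graded (π : Fin n → MvPolynomial (Fin n) ℝ)
    (hhom : ∀ i, ∃ d, 0 < d ∧ (π i).IsHomogeneous d)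
    (p : MvPolynomial (Fin n) ℝ →ₗ[ℝ] MvPolynomial (Fin n) ℝ)
    (h1 : ∀ f, p f - f ∈ Ideal.span (Set.range π))
    (h3 : ∀ f d, homogeneousComponent d (p f) = p (homogeneousComponent d f))
    (L : Submodule ℝ (MvPolynomial (Fin n) ℝ)) (hL : ∀ f, p f ∈ L)
    (hLπ : ∀ i, ∀ f ∈ L, f * π i ∈ L) (f : MvPolynomial (Fin n) ℝ) : f ∈ L := by
  have key : ∀ d f, homogeneousComponent d f ∈ L := by
    intro d
    induction d using Nat.strong_induction_on with
    | _ d ih =>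
    intro f
    have hI : ∀ h ∈ Ideal.span (Set.range π), homogeneousComponent d h ∈ L := by
      intro h hh
      obtain ⟨c, rfl⟩ := Ideal.mem_span_range_iff_exists_fun.mp hh
      rw [map_sum]
      refine L.sum_mem fun i _ => ?_
      obtain ⟨e, he0, he⟩ := hhom i
      rw [← sum_homogeneousComponent (c i), Finset.sum_mul, map_sum]
      refine L.sum_mem fun j _ => ?_
      rw [homogeneousComponent_of_mem ((homogeneousComponent_isHomogeneous j (c i)).mul he)]
      split_ifs with hde
      · exact hLπ i _ (ih j (by omega) _)
      · exact L.zero_mem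
    have h4 := hI _ (h1 f)
    rw [map_sub, h3] at h4
    have := L.sub_mem (hL (homogeneousComponent d f)) h4
    simpa using this
  rw [← sum_homogeneousComponent f]
  exact L.sum_mem fun d _ => key d f


lemma card_le_of_indep (H : Subgroup (Matrix (Fin n) (Fin n) ℝ)ˣ) [Fintype H]
    {ι : Type*} [Fintype ι] (c : ι → MvPolynomial (Fin n) ℝ)
    (hc : ∀ r : ι → invariantSubalgebra H,
      ∑ i, (r i : MvPolynomial (Fin n) ℝ) * c i = 0 → r = 0) :
    Fintype.card ι ≤ Fintype.card H := by
  classical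
  by_contra hcard
  let A : Matrix H ι (MvPolynomial (Fin n) ℝ) := fun g i => subAct H g (c i)
  obtain ⟨v, hv0, hv⟩ : ∃ v ≠ 0, A.mulVec v = 0 := by
    by_contra hcon
    push Not at hcon
    apply hcard
    apply card_le_of_injective (MvPolynomial (Fin n) ℝ) (Matrix.mulVecLin A)
    rw [injective_iff_map_eq_zero]
    intro v hv
    by_contra h
    exact hcon v h (by simpa using hv)
  let T : Matrix ι ι (invariantSubalgebra H) := fun i j => ⟨avg H (c i * c j), avg_mem H _⟩
  have hdet' : (T.map (invariantSubalgebra H).val).det = 0 := by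
    rw [← Matrix.exists_mulVec_eq_zero_iff]
    refine ⟨v, hv0, ?_⟩
    ext1 i
    have hv' : ∀ g, ∑ j, subAct H g (c j) * v j = 0 := fun g => congrFun hv g
    simp only [Matrix.mulVec, dotProduct, Matrix.map_apply, Pi.zero_apply]
    show ∑ j, avg H (c i * c j) * v j = 0
    simp only [avg_apply, smul_mul_assoc, ← Finset.smul_sum, Finset.sum_mul]
    rw [Finset.sum_comm]
    simp only [map_mul, mul_assoc, ← Finset.mul_sum, hv']
    simp
  have hdet : T.det = 0 := by
    have h := AlgHom.map_det (invariantSubalgebra H).val T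
    have h2 : (invariantSubalgebra H).val T.det = 0 := by
      rw [h]; exact hdet'
    exact Subtype.ext h2
  obtain ⟨w, hw0, hw⟩ := Matrix.exists_mulVec_eq_zero_iff.mpr hdet
  apply hw0
  apply hc
  set s := ∑ i, (w i : MvPolynomial (Fin n) ℝ) * c i with hs
  have h1 : ∀ i, avg H (c i * s) = 0 := by
    intro i
    have h := congrArg Subtype.val (congrFun hw i)
    have h' : ∑ j, avg H (c i * c j) * (w j : MvPolynomial (Fin n) ℝ) = 0 := by
      simpa [Matrix.mulVec, dotProduct, T] using h
    rw [← h', hs, Finset.mul_sum, map_sum]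
    apply Finset.sum_congr rfl
    intro j _
    rw [mul_left_comm, avg_mul H (w j).2, mul_comm]
  have h2 : avg H (s * s) = 0 := by
    conv_lhs => rw [hs, Finset.sum_mul, map_sum]
    apply Finset.sum_eq_zero
    intro i _
    rw [mul_assoc, avg_mul H (w i).2, ← hs, h1, mul_zero]
  apply MvPolynomial.funext
  intro x
  have h3 := congrArg (eval x) h2
  rw [avg_apply, smul_eval, map_sum, map_zero] at h3
  have h0 : (Fintype.card H : ℝ)⁻¹ ≠ 0 := by simp
  have h4 := (mul_eq_zero.mp h3).resolve_left h0
  simp only [map_mul] at h4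
  rw [Finset.sum_eq_zero_iff_of_nonneg (fun g _ => mul_self_nonneg _)] at h4
  have h5 := h4 1 (Finset.mem_univ _)
  rw [subAct_one] at h5
  simpa using h5

lemma exists_free_point (H : Subgroup (Matrix (Fin n) (Fin n) ℝ)ˣ) [Fintype H] :
    ∃ x : Fin n → ℝ, Function.Injective
      (fun g : H => ((g : (Matrix (Fin n) (Fin n) ℝ)ˣ) : Matrix (Fin n) (Fin n) ℝ).mulVec x) := by
  classical
  let F : H → Subspace ℝ (Fin n → ℝ) := fun g =>
    LinearMap.ker (Matrix.toLin' ((g : (Matrix (Fin n) (Fin n) ℝ)ˣ) : Matrix (Fin n) (Fin n) ℝ)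
      - LinearMap.id)
  have hF : ⊤ ∉ (Finset.univ.filter (fun g : H => g ≠ 1)).image F := by
    intro h
    obtain ⟨g, hg, hgt⟩ := Finset.mem_image.mp h
    rw [Finset.mem_filter] at hg
    apply hg.2
    rw [LinearMap.ker_eq_top, sub_eq_zero] at hgt
    have h3 : ((g : (Matrix (Fin n) (Fin n) ℝ)ˣ) : Matrix (Fin n) (Fin n) ℝ) = 1 := by
      apply Matrix.toLin'.injective
      rw [hgt, Matrix.toLin'_one]
    exact Subtype.ext (Units.ext h3)
  have := Subspace.biUnion_ne_univ_of_top_notMem hF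
  obtain ⟨x, hx⟩ := (Set.ne_univ_iff_exists_notMem _).mp this
  refine ⟨x, fun g h hgh => ?_⟩
  by_contra hne
  apply hx
  simp only [Set.mem_iUnion]
  refine ⟨F (g⁻¹ * h), Finset.mem_image.mpr ⟨g⁻¹ * h, ?_, rfl⟩, ?_⟩
  · rw [Finset.mem_filter]
    exact ⟨Finset.mem_univ _, fun h1 => hne (inv_mul_eq_one.mp h1)⟩
  · simp only [F, SetLike.mem_coe, LinearMap.mem_ker, LinearMap.sub_apply, Matrix.toLin'_apply,
      LinearMap.id_apply, sub_eq_zero]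
    have hgh' : ((g : (Matrix (Fin n) (Fin n) ℝ)ˣ) : Matrix (Fin n) (Fin n) ℝ).mulVec x =
      ((h : (Matrix (Fin n) (Fin n) ℝ)ˣ) : Matrix (Fin n) (Fin n) ℝ).mulVec x := hgh
    rw [Subgroup.coe_mul, Units.val_mul, ← Matrix.mulVec_mulVec, ← hgh', Matrix.mulVec_mulVec,
      ← Units.val_mul, Subgroup.coe_inv, inv_mul_cancel, Units.val_one, Matrix.one_mulVec]

lemma interpolate {κ : Type*} [Fintype κ] (y : κ → (Fin n → ℝ)) (hy : Function.Injective y)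
    (t : κ → ℝ) : ∃ f : MvPolynomial (Fin n) ℝ, ∀ k, eval (y k) f = t k := by
  classical
  have hsep : ∀ k l, ∃ q : MvPolynomial (Fin n) ℝ, k ≠ l → eval (y k) q = 1 ∧ eval (y l) q = 0 := by
    intro k l
    by_cases hkl : k = l
    · exact ⟨0, fun h => absurd hkl h⟩
    · obtain ⟨i, hi⟩ := Function.ne_iff.mp (fun h => hkl (hy h))
      refine ⟨C ((y k i - y l i)⁻¹) * (X i - C (y l i)), fun _ => ⟨?_, ?_⟩⟩
      · simp [sub_ne_zero.mpr hi]
      · simp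
  choose q hq using hsep
  refine ⟨∑ k, C (t k) * ∏ l ∈ Finset.univ.erase k, q k l, fun k => ?_⟩
  rw [map_sum, Finset.sum_eq_single k]
  · rw [map_mul, map_prod, Finset.prod_eq_one]
    · simp
    · intro l hl
      exact (hq k l (Finset.ne_of_mem_erase hl).symm).1
  · intro m _ hm
    rw [map_mul, map_prod, Finset.prod_eq_zero (i := k), mul_zero]
    · simp [hm.symm]
    · exact (hq m k hm).2
  · simp

lemma eval_inv (H : Subgroup (Matrix (Fin n) (Fin n) ℝ)ˣ) {r : MvPolynomial (Fin n) ℝ}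
    (hr : r ∈ invariantSubalgebra H) (k : H) (x : Fin n → ℝ) :
    eval (((k : (Matrix (Fin n) (Fin n) ℝ)ˣ) : Matrix (Fin n) (Fin n) ℝ).mulVec x) r =
      eval x r := by
  have h1 : subAct H k⁻¹ r = r := hr k⁻¹
  rw [← eval_polyAct]
  conv_rhs => rw [← h1]
  simp [subAct]

lemma indep_tmul {R V ι : Type*} [AddCommGroup R] [Module ℝ R] [AddCommGroup V] [Module ℝ V]
    [Fintype ι] (v : ι → V) (hv : LinearIndependent ℝ v) (r : ι → R)
    (h : ∑ i, r i ⊗ₜ[ℝ] v i = 0) : r = 0 := by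
  classical
  obtain ⟨L, hL⟩ := LinearMap.exists_leftInverse_of_injective _
    (LinearMap.ker_eq_bot.mpr hv)
  ext1 i
  have h1 := congrArg (TensorProduct.rid ℝ R ∘ LinearMap.lTensor R (Finsupp.lapply i ∘ₗ L)) h
  have h2 : ∀ j, L (v j) = Finsupp.single j 1 := by
    intro j
    have := LinearMap.congr_fun hL (Finsupp.single j 1)
    simpa using this
  simpa [h2, Finsupp.single_apply] using h1

end CovAlg

/-- **The covariant algebra of a finite real reflection group.**
Let `H ⊆ GLₙ(ℝ)` be a finite reflection group with minimal algebraically independent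
homogeneous fundamental invariants `π_1, …, π_n`.  Then the covariant algebra
`ℝ[X]_H := ℝ[X]/(π_1,…,π_n)` is isomorphic, as an `H`-module, to the regular
representation of `H`, and `ℝ[X] ≅ ℝ[X]^H ⊗ ℝ[X]_H` as graded `H`-modules. -/
theorem covariant_algebra_regular_rep {n : ℕ}
    (H : Subgroup (Matrix (Fin n) (Fin n) ℝ)ˣ) [Finite H]
    (hrefl : H = Subgroup.closure {g : (Matrix (Fin n) (Fin n) ℝ)ˣ |
      g ∈ H ∧ IsReflection (↑g : Matrix (Fin n) (Fin n) ℝ)})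
    (π : Fin n → MvPolynomial (Fin n) ℝ)
    (hind : AlgebraicIndependent ℝ π)
    (hhom : ∀ i, ∃ d, 0 < d ∧ (π i).IsHomogeneous d)
    (hinv : ∀ i, π i ∈ invariantSubalgebra H)
    (hgen : ∀ f ∈ invariantSubalgebra H, f ∈ Algebra.adjoin ℝ (Set.range π)) :
    -- (1) the covariant algebra is isomorphic to the regular representation as `H`-modules
    (∃ e : (MvPolynomial (Fin n) ℝ ⧸ Ideal.span (Set.range π)) ≃ₗ[ℝ] (↥H → ℝ),
      ∀ (f : MvPolynomial (Fin n) ℝ) (g : ↥H),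
        e (Ideal.Quotient.mk (Ideal.span (Set.range π)) (subAct H g f)) =
          fun x => e (Ideal.Quotient.mk (Ideal.span (Set.range π)) f) (g⁻¹ * x)) ∧
    -- (2) `ℝ[X] ≅ ℝ[X]^H ⊗ ℝ[X]_H` as graded `H`-modules
    (∃ e : (↥(invariantSubalgebra H) ⊗[ℝ]
              (MvPolynomial (Fin n) ℝ ⧸ Ideal.span (Set.range π))) ≃ₗ[ℝ]
            MvPolynomial (Fin n) ℝ,
      -- the isomorphism is graded
      (∀ (f : MvPolynomial (Fin n) ℝ) (hf : f ∈ invariantSubalgebra H)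
          (a b : ℕ), f.IsHomogeneous a → ∀ h : MvPolynomial (Fin n) ℝ, h.IsHomogeneous b →
        (e ((⟨f, hf⟩ : ↥(invariantSubalgebra H)) ⊗ₜ[ℝ]
            Ideal.Quotient.mk (Ideal.span (Set.range π)) h)).IsHomogeneous (a + b)) ∧
      -- the isomorphism is `H`-equivariant (trivial action on the invariants)
      (∀ (f : MvPolynomial (Fin n) ℝ) (hf : f ∈ invariantSubalgebra H)
          (h : MvPolynomial (Fin n) ℝ) (g : ↥H),
        e ((⟨f, hf⟩ : ↥(invariantSubalgebra H)) ⊗ₜ[ℝ]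
            Ideal.Quotient.mk (Ideal.span (Set.range π)) (subAct H g h)) =
          subAct H g (e ((⟨f, hf⟩ : ↥(invariantSubalgebra H)) ⊗ₜ[ℝ]
            Ideal.Quotient.mk (Ideal.span (Set.range π)) h)))) := by
  classical
  cases nonempty_fintype H
  set I := Ideal.span (Set.range π) with hIdef
  obtain ⟨p, hp1, hp2, hp3, hp4⟩ := CovAlg.exists_proj H I
    (fun f hf d => CovAlg.hc_mem π hhom hf d) (fun g f hf => CovAlg.subAct_mem H π hinv g hf)
  -- the section
  have hwd : ∀ f f', Ideal.Quotient.mk I f = Ideal.Quotient.mk I f' → p f = p f' := by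
    intro f f' h
    rw [← sub_eq_zero, ← map_sub]
    exact hp2 _ (Ideal.Quotient.eq.mp h)
  obtain ⟨σ, hσ⟩ : ∃ σ : (MvPolynomial (Fin n) ℝ ⧸ I) →ₗ[ℝ] MvPolynomial (Fin n) ℝ,
      ∀ f, σ (Ideal.Quotient.mk I f) = p f := by
    have hs := Ideal.Quotient.mk_surjective (I := I)
    refine ⟨{ toFun := fun q => p (Function.surjInv hs q), map_add' := ?_, map_smul' := ?_ }, ?_⟩
    · intro a b
      rw [← map_add]
      apply hwd
      rw [map_add]
      simp only [Function.surjInv_eq hs]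
    · intro c a
      simp only [RingHom.id_apply]
      rw [← map_smul]
      apply hwd
      have : Ideal.Quotient.mk I (c • Function.surjInv hs a) =
        c • Ideal.Quotient.mk I (Function.surjInv hs a) := rfl
      rw [this]
      simp only [Function.surjInv_eq hs]
    · intro f
      exact hwd _ _ (Function.surjInv_eq hs _)
  have hmkσ : ∀ q, Ideal.Quotient.mk I (σ q) = q := by
    intro q
    obtain ⟨f, rfl⟩ := Ideal.Quotient.mk_surjective q
    rw [hσ]
    exact Ideal.Quotient.eq.mpr (hp1 f)
  let μ : (↥(invariantSubalgebra H) ⊗[ℝ] (MvPolynomial (Fin n) ℝ ⧸ I)) →ₗ[ℝ]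
      MvPolynomial (Fin n) ℝ :=
    LinearMap.mul' ℝ (MvPolynomial (Fin n) ℝ) ∘ₗ
      TensorProduct.map (invariantSubalgebra H).val.toLinearMap σ
  have hμ : ∀ r q, μ (r ⊗ₜ q) = (r : MvPolynomial (Fin n) ℝ) * σ q := by
    intro r q; simp [μ]
  -- basis of the invariants
  have hmon : ∀ Q : MvPolynomial (Fin n) ℝ, aeval π Q ∈ invariantSubalgebra H := by
    intro Q
    have : Algebra.adjoin ℝ (Set.range π) ≤ invariantSubalgebra H :=
      Algebra.adjoin_le (by rintro _ ⟨i, rfl⟩; exact hinv i)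
    apply this
    rw [Algebra.adjoin_range_eq_range_aeval]
    exact ⟨Q, rfl⟩
  let ψ : MvPolynomial (Fin n) ℝ →ₐ[ℝ] invariantSubalgebra H :=
    (aeval π).codRestrict (invariantSubalgebra H) hmon
  have hψ : Function.Bijective ψ := by
    constructor
    · intro a b hab
      exact hind (congrArg Subtype.val hab)
    · rintro ⟨f, hf⟩
      have := hgen f hf
      rw [Algebra.adjoin_range_eq_range_aeval] at this
      obtain ⟨Q, hQ⟩ := this
      exact ⟨Q, Subtype.ext hQ⟩
  let bR := (basisMonomials (Fin n) ℝ).map (LinearEquiv.ofBijective ψ.toLinearMap hψ)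
  have hbR : ∀ a, ((bR a : invariantSubalgebra H) : MvPolynomial (Fin n) ℝ) =
      aeval π (monomial a (1 : ℝ)) := by
    intro a
    simp [bR, ψ]
  have hμinj : Function.Injective μ := by
    rw [injective_iff_map_eq_zero]
    intro z hz
    obtain ⟨c, rfl⟩ := TensorProduct.eq_repr_basis_left bR z
    by_cases hc : c = 0
    · simp [hc]
    exfalso
    obtain ⟨a₀, ha₀⟩ := exists_minimal_of_wellFoundedLT (fun a => a ∈ c.support)
      (Finsupp.support_nonempty_iff.mpr hc)
    have h1 := CovAlg.chevalley H hrefl π hind hinv hgen c.support a₀ ha₀.prop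
      (fun a ha hle => le_antisymm hle (ha₀.le_of_le ha hle)) _ (fun a => σ (c a))
      (Nat.lt_succ_self _) (by
        rw [← hz, Finsupp.sum, map_sum]
        apply Finset.sum_congr rfl
        intro a _
        rw [hμ, hbR])
    have h2 : Ideal.Quotient.mk I (σ (c a₀)) = 0 := Ideal.Quotient.eq_zero_iff_mem.mpr h1
    rw [hmkσ] at h2
    exact (Finsupp.mem_support_iff.mp ha₀.prop) h2
  have hμsurj : Function.Surjective μ := by
    intro f
    refine CovAlg.mem_of_graded π hhom p hp1 hp3 (LinearMap.range μ) ?_ ?_ f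
    · intro f
      exact ⟨1 ⊗ₜ Ideal.Quotient.mk I f, by rw [hμ, hσ]; simp⟩
    · rintro i _ ⟨z, rfl⟩
      induction z using TensorProduct.induction_on with
      | zero => simp
      | add x y hx hy => rw [map_add, add_mul]; exact Submodule.add_mem _ hx hy
      | tmul r q =>
        refine ⟨(r * ⟨π i, hinv i⟩) ⊗ₜ q, ?_⟩
        rw [hμ, hμ]
        simp only [MulMemClass.coe_mul]
        ring
  have hμbij : Function.Bijective μ := ⟨hμinj, hμsurj⟩
  obtain ⟨eμ, heμ⟩ : ∃ e : (↥(invariantSubalgebra H) ⊗[ℝ] (MvPolynomial (Fin n) ℝ ⧸ I)) ≃ₗ[ℝ]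
      MvPolynomial (Fin n) ℝ, ∀ z, e z = μ z := ⟨LinearEquiv.ofBijective μ hμbij, fun _ => rfl⟩
  refine ⟨?_, eμ, ?_, ?_⟩
  · obtain ⟨x, hx⟩ := CovAlg.exists_free_point H
    let ev : MvPolynomial (Fin n) ℝ →ₗ[ℝ] (H → ℝ) := LinearMap.pi fun k =>
      (aeval (((k : (Matrix (Fin n) (Fin n) ℝ)ˣ) : Matrix (Fin n) (Fin n) ℝ).mulVec x) :
        MvPolynomial (Fin n) ℝ →ₐ[ℝ] ℝ).toLinearMap
    have hev : ∀ f k, ev f k =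
        eval (((k : (Matrix (Fin n) (Fin n) ℝ)ˣ) : Matrix (Fin n) (Fin n) ℝ).mulVec x) f := by
      intro f k; simp [ev, MvPolynomial.aeval_eq_eval]
    let E := ev ∘ₗ σ
    have hEsurj : Function.Surjective E := by
      intro t
      obtain ⟨f, hf⟩ := CovAlg.interpolate _ hx t
      have hft : ev f = t := by ext k; rw [hev, hf]
      have := CovAlg.mem_of_graded π hhom p hp1 hp3 ((LinearMap.range E).comap ev) ?_ ?_ f
      · rw [Submodule.mem_comap, hft] at this
        exact this
      · intro f
        exact ⟨Ideal.Quotient.mk I f, by simp [E, hσ]⟩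
      · intro i f hf
        rw [Submodule.mem_comap] at hf ⊢
        have : ev (f * π i) = (eval x (π i)) • ev f := by
          ext k
          rw [hev, map_mul, CovAlg.eval_inv H (hinv i), Pi.smul_apply, hev, smul_eq_mul, mul_comm]
        rw [this]
        exact Submodule.smul_mem _ _ hf
    have hrank : Module.rank ℝ (MvPolynomial (Fin n) ℝ ⧸ I) ≤ (Fintype.card H : ℕ) := by
      apply rank_le
      intro s hs
      have := CovAlg.card_le_of_indep H (fun i : s => σ (i : MvPolynomial (Fin n) ℝ ⧸ I)) (by
        intro r hr
        apply CovAlg.indep_tmul _ hs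
        apply hμinj
        rw [map_zero, ← hr, map_sum]
        simp only [hμ])
      simpa using this
    have hfin : Module.Finite ℝ (MvPolynomial (Fin n) ℝ ⧸ I) :=
      Module.rank_lt_aleph0_iff.mp (hrank.trans_lt (Cardinal.natCast_lt_aleph0))
    have hfr : Module.finrank ℝ (MvPolynomial (Fin n) ℝ ⧸ I) = Module.finrank ℝ (H → ℝ) := by
      apply le_antisymm
      · rw [Module.finrank_fintype_fun_eq_card]
        exact Module.finrank_le_of_rank_le hrank
      · exact LinearMap.finrank_le_finrank_of_surjective hEsurj
    have hEinj : Function.Injective E :=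
      (LinearMap.injective_iff_surjective_of_finrank_eq_finrank hfr).mpr hEsurj
    have hEbij : Function.Bijective E := ⟨hEinj, hEsurj⟩
    obtain ⟨eE, heE⟩ : ∃ e : (MvPolynomial (Fin n) ℝ ⧸ I) ≃ₗ[ℝ] (H → ℝ), ∀ z, e z = E z :=
      ⟨LinearEquiv.ofBijective E hEbij, fun _ => rfl⟩
    refine ⟨eE, ?_⟩
    intro f g
    ext k
    simp only [heE, E, LinearMap.comp_apply, hσ, hp4, hev]
    rw [subAct, CovAlg.eval_polyAct, Matrix.mulVec_mulVec]
    simp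
  · intro f hf a b ha h hb
    rw [heμ, hμ, hσ]
    apply ha.mul
    rw [← homogeneousComponent_eq_self hb, ← hp3]
    exact homogeneousComponent_isHomogeneous _ _
  · intro f hf h g
    simp only [heμ, hμ, hσ, hp4, map_mul]
    have : subAct H g f = f := hf g
    rw [this]
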